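/- arXiv:math/0309317 — 3 statements merged into one kernel-verified Lean document; each statement's English description precedes it below -/
import Mathlib

section
/- Let 1 < p < 2 and d ≥ 1, and set k = ⌈log((1 − 2^{p−2})^{−1}) / log 2⌉ − 1. Then there exists an equilateral set in ℓ_p^d of cardinality ⌊2^{k+1} d / (2^{k+1} − 1)⌋. -/
open Real

/-- A finite set `S` in `ℝ^d` is `lam`-equilateral for the `ℓ_p` norm
(`‖x‖_p = (∑ i, |x i| ^ p) ^ (1/p)`). -/
def IsEquilateralLp {d : ℕ} (p : ℝ) (lam : ℝ) (S : Finset (Fin d → ℝ)) : Prop :=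
  ∀ x ∈ S, ∀ y ∈ S, x ≠ y → (∑ i, |x i - y i| ^ p) ^ (1 / p) = lam

/-- A family of vectors, all of `ℓ_p`-norm `1`, whose pairwise `ℓ_p`-distances are `2 ^ (1 / p)`. -/
def IsUnitEquilateral {P C : Type} [Fintype C] (p : ℝ) (x : P → C → ℝ) : Prop :=
  (∀ i, ∑ c, |x i c| ^ p = 1) ∧ ∀ i j, i ≠ j → ∑ c, |x i c - x j c| ^ p = 2

lemma IsUnitEquilateral.comp_equiv {P C P' C' : Type} [Fintype C] [Fintype C'] {p : ℝ}
    {x : P → C → ℝ} (hx : IsUnitEquilateral p x) (e : P' ≃ P) (f : C' ≃ C) :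
    IsUnitEquilateral p (fun i c => x (e i) (f c)) := by
  refine ⟨fun i => ?_, fun i j hij => ?_⟩
  · rw [f.sum_comp (fun c => |x (e i) c| ^ p)]
    exact hx.1 _
  · rw [f.sum_comp (fun c => |x (e i) c - x (e j) c| ^ p)]
    exact hx.2 _ _ (e.injective.ne hij)

/-- Two families placed in complementary coordinate subspaces. -/
def directSum {P C P' C' : Type} (x : P → C → ℝ) (y : P' → C' → ℝ) : P ⊕ P' → C ⊕ C' → ℝ :=
  Sum.elim (fun i => Sum.elim (x i) 0) (fun j => Sum.elim 0 (y j))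

lemma IsUnitEquilateral.directSum {P C P' C' : Type} [Fintype C] [Fintype C'] {p : ℝ} (hp : p ≠ 0)
    {x : P → C → ℝ} {y : P' → C' → ℝ} (hx : IsUnitEquilateral p x) (hy : IsUnitEquilateral p y) :
    IsUnitEquilateral p (directSum x y) := by
  refine ⟨?_, ?_⟩
  · rintro (i | i) <;> simp [_root_.directSum, Real.zero_rpow hp, hx.1, hy.1]
  · rintro (i | i) (j | j) hij
    · simp [_root_.directSum, Real.zero_rpow hp, hx.2 i j (by simpa using hij)]
    · simp [_root_.directSum, hx.1, hy.1]; norm_num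
    · simp [_root_.directSum, hx.1, hy.1]; norm_num
    · simp [_root_.directSum, Real.zero_rpow hp, hy.2 i j (by simpa using hij)]

lemma exists_isUnitEquilateral_add {p : ℝ} (hp : p ≠ 0) {m d m' d' : ℕ}
    (h : ∃ x : Fin m → Fin d → ℝ, IsUnitEquilateral p x)
    (h' : ∃ x : Fin m' → Fin d' → ℝ, IsUnitEquilateral p x) :
    ∃ x : Fin (m + m') → Fin (d + d') → ℝ, IsUnitEquilateral p x := by
  obtain ⟨x, hx⟩ := h
  obtain ⟨y, hy⟩ := h'
  exact ⟨_, (hx.directSum hp hy).comp_equiv finSumFinEquiv.symm finSumFinEquiv.symm⟩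

lemma exists_isUnitEquilateral_mul {p : ℝ} (hp : p ≠ 0) {m d : ℕ}
    (h : ∃ x : Fin m → Fin d → ℝ, IsUnitEquilateral p x) (q : ℕ) :
    ∃ x : Fin (q * m) → Fin (q * d) → ℝ, IsUnitEquilateral p x := by
  induction q with
  | zero =>
    rw [Nat.zero_mul]
    exact ⟨fun i => i.elim0, fun i => i.elim0, fun i => i.elim0⟩
  | succ q ih =>
    rw [Nat.succ_mul, Nat.succ_mul]
    exact exists_isUnitEquilateral_add hp ih h

lemma exists_isUnitEquilateral_self {p : ℝ} (hp : p ≠ 0) (r : ℕ) :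
    ∃ x : Fin r → Fin r → ℝ, IsUnitEquilateral p x := by
  have h1 : ∃ x : Fin 1 → Fin 1 → ℝ, IsUnitEquilateral p x :=
    ⟨fun _ _ => 1, by simp, fun i j hij => (hij (Subsingleton.elim _ _)).elim⟩
  have h := exists_isUnitEquilateral_mul hp h1 r
  rwa [Nat.mul_one] at h

/-- A twisted doubling of a family of vectors; with `a = u = v = 1` it is Sylvester's doubling of
Hadamard matrices with the constant column removed. -/
def twistedDouble {P C : Type} (a u v : ℝ) (x : P → C → ℝ) : P ⊕ P → Option (C ⊕ C) → ℝ :=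
  Sum.elim
    (fun i c => c.elim a (Sum.elim (fun c => u * x i c) (fun c => v * x i c)))
    (fun i c => c.elim (-a) (Sum.elim (fun c => v * x i c) (fun c => -(u * x i c))))

section TwistedDouble

variable {P C : Type} [Fintype C] {p a u v D : ℝ} {x : P → C → ℝ}

lemma abs_eq_one_of_sign {s : ℝ} (hs : s = 1 ∨ s = -1) : |s| = 1 := by
  rcases hs with h | h <;> simp [h]

lemma sum_abs_twistedDouble (hx : ∀ i c, x i c = 1 ∨ x i c = -1) (i : P ⊕ P) :
    ∑ c, |twistedDouble a u v x i c| ^ p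
      = |a| ^ p + Fintype.card C * (|u| ^ p + |v| ^ p) := by
  have h : ∀ i c, |x i c| = 1 := fun i c => abs_eq_one_of_sign (hx i c)
  rcases i with i | i <;> simp [twistedDouble, Fintype.sum_option, abs_mul, h] <;> ring

lemma sum_abs_twistedDouble_sub (hx : ∀ i c, x i c = 1 ∨ x i c = -1)
    (hD : ∀ i j, i ≠ j → ∑ c, |x i c - x j c| ^ p = D)
    (hW : (|u| ^ p + |v| ^ p) * D = |2 * a| ^ p + Fintype.card C * (|u - v| ^ p + |u + v| ^ p))
    (i j : P ⊕ P) (hij : i ≠ j) (hp : p ≠ 0) :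
    ∑ c, |twistedDouble a u v x i c - twistedDouble a u v x j c| ^ p
      = (|u| ^ p + |v| ^ p) * D := by
  have same : ∀ (w : ℝ) (i j : P), i ≠ j →
      ∑ c, |w * x i c - w * x j c| ^ p = |w| ^ p * D := by
    intro w i j hij
    rw [← hD i j hij, Finset.mul_sum]
    refine Finset.sum_congr rfl fun c _ => ?_
    rw [← mul_sub, abs_mul, Real.mul_rpow (abs_nonneg _) (abs_nonneg _)]
  have cross : ∀ i j : P, ∑ c, |u * x i c - v * x j c| ^ p + ∑ c, |v * x i c + u * x j c| ^ p
      = Fintype.card C * (|u - v| ^ p + |u + v| ^ p) := by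
    intro i j
    rw [← Finset.sum_add_distrib, ← nsmul_eq_mul, ← Finset.card_univ, ← Finset.sum_const]
    refine Finset.sum_congr rfl fun c _ => ?_
    have e1 : |-u - v| = |u + v| := by rw [← abs_neg]; ring_nf
    have e2 : |-u + v| = |u - v| := by rw [← abs_neg]; ring_nf
    have e3 : |v + -u| = |u - v| := by rw [← abs_neg]; ring_nf
    have e4 : |-v + -u| = |u + v| := by rw [← abs_neg]; ring_nf
    rcases hx i c with h1 | h1 <;> rcases hx j c with h2 | h2 <;>
      simp only [h1, h2, mul_one, mul_neg, sub_neg_eq_add, e1, e2, e3, e4]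
    · rw [add_comm v u]
    · ring
    · rw [show -v + u = u - v by ring]; ring
  have e5 : |-a - a| = |2 * a| := by rw [← abs_neg]; ring_nf
  rcases i with i | i <;> rcases j with j | j
  · have hij' : i ≠ j := by simpa using hij
    simp [twistedDouble, Fintype.sum_option, Real.zero_rpow hp, same _ i j hij']
    ring
  · simp only [twistedDouble, Fintype.sum_option, Fintype.sum_sum_type, Sum.elim_inl,
      Sum.elim_inr, Option.elim_none, Option.elim_some, sub_neg_eq_add, cross]
    rw [hW, ← two_mul]
  · rw [hW, ← cross j i]
    simp only [twistedDouble, Fintype.sum_option, Fintype.sum_sum_type, Sum.elim_inl,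
      Sum.elim_inr, Option.elim_none, Option.elim_some, e5]
    congr 2
    · exact Finset.sum_congr rfl fun c _ => by rw [abs_sub_comm]
    · exact Finset.sum_congr rfl fun c _ => by rw [← abs_neg]; ring_nf
  · have hij' : i ≠ j := by simpa using hij
    have h := same (-u) i j hij'
    simp only [neg_mul, abs_neg] at h
    simp only [twistedDouble, Fintype.sum_option, Fintype.sum_sum_type, Sum.elim_inr,
      Sum.elim_inl, Option.elim_none, Option.elim_some, same _ i j hij', h]
    simp [Real.zero_rpow hp]
    ring

end TwistedDouble

lemma exists_hadamard_family {p : ℝ} (hp : p ≠ 0) (k : ℕ) :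
    ∃ (P C : Type) (_ : Fintype P) (_ : Fintype C) (x : P → C → ℝ),
      Fintype.card P = 2 ^ k ∧ Fintype.card C + 1 = 2 ^ k ∧
      (∀ i c, x i c = 1 ∨ x i c = -1) ∧
      ∀ i j, i ≠ j → ∑ c, |x i c - x j c| ^ p = 2 ^ k * 2 ^ p / 2 := by
  induction k with
  | zero =>
    exact ⟨Unit, Empty, inferInstance, inferInstance, fun _ c => c.elim, by simp, by simp,
      fun _ c => c.elim, fun i j hij => (hij rfl).elim⟩
  | succ k ih =>
    obtain ⟨P, C, _, _, x, hP, hC, hx, hD⟩ := ih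
    have hC' : (Fintype.card C : ℝ) + 1 = 2 ^ k := by exact_mod_cast hC
    refine ⟨P ⊕ P, Option (C ⊕ C), inferInstance, inferInstance, twistedDouble 1 1 1 x,
      ?_, ?_, ?_, fun i j hij => ?_⟩
    · rw [Fintype.card_sum, hP]; ring
    · rw [Fintype.card_option, Fintype.card_sum, pow_succ]; omega
    · rintro (i | i) (_ | c | c) <;> simp [twistedDouble]
      · exact hx i c
      · exact hx i c
      · exact hx i c
      · rcases hx i c with h | h <;> simp [h]
    · rw [sum_abs_twistedDouble_sub hx hD _ i j hij hp]
      · simp; ring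
      · rw [← hC']
        norm_num [Real.zero_rpow hp]
        ring

lemma exists_twist_parameters {p w N : ℝ} (hp : 0 < p) (hw : 1 / 2 < w)
    (hpw : (2 : ℝ) ^ p = 4 * w) (hN : 1 ≤ N) (h1 : N * (1 - w) < 1)
    (h2 : 1 ≤ 2 * N * (1 - w)) :
    ∃ a u v : ℝ, |u| ^ p + |v| ^ p = 1 / (w * N) ∧
      |a| ^ p + (N - 1) * (|u| ^ p + |v| ^ p) = 1 ∧
      |2 * a| ^ p + (N - 1) * (|u - v| ^ p + |u + v| ^ p) = 2 := by
  have hw0 : 0 < w := by linarith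
  have hN0 : 0 < N := by linarith
  set B := 1 / (w * N) with hB
  have hB0 : 0 < B := by positivity
  have hBw : B * (w * N) = 1 := by rw [hB]; field_simp
  set A := 1 - (N - 1) * B with hA
  have hA0 : 0 ≤ A := by
    have : A = (w * N - (N - 1)) * B := by rw [hA, ← hBw]; ring
    rw [this]
    exact mul_nonneg (by nlinarith) hB0.le
  have root : ∀ s : ℝ, 0 ≤ s → |s ^ (1 / p)| ^ p = s := fun s hs => by
    rw [abs_of_nonneg (Real.rpow_nonneg hs _), ← Real.rpow_mul hs, one_div_mul_cancel hp.ne',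
      Real.rpow_one]
  have two_mul_root : ∀ s : ℝ, 0 ≤ s → |2 * s ^ (1 / p)| ^ p = 4 * w * s := fun s hs => by
    rw [abs_mul, Real.mul_rpow (abs_nonneg _) (abs_nonneg _), root s hs, abs_two, hpw]
  let G : ℝ → ℝ := fun s => 4 * w * A + (N - 1) *
    (|s ^ (1 / p) - (B - s) ^ (1 / p)| ^ p + |s ^ (1 / p) + (B - s) ^ (1 / p)| ^ p)
  have hp' : 0 ≤ 1 / p := by positivity
  have hG : Continuous G := by
    have c1 : Continuous fun s : ℝ => s ^ (1 / p) := Real.continuous_rpow_const hp'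
    have c2 : Continuous fun s : ℝ => (B - s) ^ (1 / p) :=
      c1.comp (continuous_const.sub continuous_id)
    exact continuous_const.add (continuous_const.mul
      (((c1.sub c2).abs.rpow_const fun _ => Or.inr hp.le).add
        ((c1.add c2).abs.rpow_const fun _ => Or.inr hp.le)))
  have hlo : G (B / 2) ≤ 2 := by
    have e : G (B / 2) = 4 * w * A + (N - 1) * (2 * w * B) := by
      simp only [G]
      rw [show B - B / 2 = B / 2 by ring, sub_self, ← two_mul, two_mul_root _ (by positivity),
        abs_zero, Real.zero_rpow hp.ne']
      ring
    rw [e]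
    have : 2 - (4 * w * A + (N - 1) * (2 * w * B))
        = (2 * B * w) * (2 * N * (1 - w) - 1) := by
      linear_combination (4 * w - 2) * hBw
    have h3 := mul_nonneg (by positivity : 0 ≤ 2 * B * w) (sub_nonneg.2 h2)
    linarith
  have hhi : 2 ≤ G B := by
    have e : G B = 4 * w * A + (N - 1) * (2 * B) := by
      simp only [G]
      rw [sub_self, Real.zero_rpow (by positivity), sub_zero, add_zero, root B hB0.le]
      ring
    rw [e]
    have : 4 * w * A + (N - 1) * (2 * B) - 2
        = (2 * B) * ((2 * w - 1) * (1 - N * (1 - w))) := by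
      linear_combination (2 - 4 * w) * hBw
    have h3 : 0 ≤ (2 * B) * ((2 * w - 1) * (1 - N * (1 - w))) :=
      mul_nonneg (by positivity) (mul_nonneg (by linarith) (by linarith))
    linarith
  obtain ⟨s, ⟨hs1, hs2⟩, hs⟩ := intermediate_value_Icc (by linarith : B / 2 ≤ B)
    hG.continuousOn ⟨hlo, hhi⟩
  have e1 := root s (by linarith)
  have e2 := root (B - s) (by linarith)
  refine ⟨A ^ (1 / p), s ^ (1 / p), (B - s) ^ (1 / p), ?_, ?_, ?_⟩
  · rw [e1, e2]; ring
  · rw [e1, e2, root A hA0, hA]; ring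
  · rw [two_mul_root A hA0]; exact hs

lemma exists_isUnitEquilateral_two_pow {p w : ℝ} (hp : 0 < p) (hw : 1 / 2 < w)
    (hpw : (2 : ℝ) ^ p = 4 * w) (k : ℕ) (h1 : 2 ^ k * (1 - w) < 1)
    (h2 : 1 ≤ 2 * 2 ^ k * (1 - w)) :
    ∃ x : Fin (2 ^ (k + 1)) → Fin (2 ^ (k + 1) - 1) → ℝ, IsUnitEquilateral p x := by
  obtain ⟨P, C, _, _, x, hP, hC, hx, hD⟩ := exists_hadamard_family hp.ne' k
  have hC' : (Fintype.card C : ℝ) = 2 ^ k - 1 := by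
    rw [eq_sub_iff_add_eq]; exact_mod_cast hC
  obtain ⟨a, u, v, huv, hnorm, hdist⟩ :=
    exists_twist_parameters hp hw hpw (one_le_pow₀ one_le_two : (1 : ℝ) ≤ 2 ^ k) h1 h2
  have hW : (|u| ^ p + |v| ^ p) * (2 ^ k * 2 ^ p / 2) = 2 := by
    rw [huv, hpw]; field_simp; norm_num
  have key : IsUnitEquilateral p (twistedDouble a u v x) := by
    refine ⟨fun i => ?_, fun i j hij => ?_⟩
    · rw [sum_abs_twistedDouble hx, hC', hnorm]
    · rw [sum_abs_twistedDouble_sub hx hD (by rw [hW, hC', hdist]) i j hij hp.ne', hW]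
  refine ⟨_, key.comp_equiv (Fintype.equivFinOfCardEq ?_).symm (Fintype.equivFinOfCardEq ?_).symm⟩
  · rw [Fintype.card_sum, hP]; ring
  · rw [Fintype.card_option, Fintype.card_sum, pow_succ]; omega

lemma IsUnitEquilateral.exists_finset {p : ℝ} (hp : p ≠ 0) {m d : ℕ} {x : Fin m → Fin d → ℝ}
    (hx : IsUnitEquilateral p x) :
    ∃ S : Finset (Fin d → ℝ), IsEquilateralLp p (2 ^ (1 / p)) S ∧ S.card = m := by
  classical
  have hinj : Function.Injective x := by
    intro i j hij
    by_contra hne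
    have := hx.2 i j hne
    simp [hij, Real.zero_rpow hp] at this
  refine ⟨Finset.univ.image x, ?_, ?_⟩
  · intro y hy z hz hyz
    obtain ⟨i, -, rfl⟩ := Finset.mem_image.1 hy
    obtain ⟨j, -, rfl⟩ := Finset.mem_image.1 hz
    rw [hx.2 i j (fun h => hyz (by rw [h]))]
  · rw [Finset.card_image_of_injective _ hinj, Finset.card_univ, Fintype.card_fin]

lemma two_zpow_bounds_of_eq_ceil_logb_sub_one {X : ℝ} (hX : 0 < X) {k : ℤ}
    (hk : k = ⌈Real.log X / Real.log 2⌉ - 1) : (2 : ℝ) ^ k < X ∧ X ≤ 2 ^ (k + 1) := by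
  have hk' : ⌈Real.log X / Real.log 2⌉ = k + 1 := by omega
  obtain ⟨h1, h2⟩ := Int.ceil_eq_iff.1 hk'
  rw [← Real.rpow_intCast, ← Real.rpow_intCast]
  push_cast at h1 h2 ⊢
  rw [add_sub_cancel_right] at h1
  exact ⟨(Real.lt_logb_iff_rpow_lt one_lt_two hX).1 h1,
    (Real.logb_le_iff_le_rpow one_lt_two hX).1 h2⟩

lemma floor_succ_mul_div {n d : ℕ} (hn : 0 < n) :
    ⌊((n : ℝ) + 1) * d / n⌋ = ((d / n * (n + 1) + d % n : ℕ) : ℤ) := by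
  have hn' : (0 : ℝ) < n := by exact_mod_cast hn
  obtain ⟨q, r, hr, hd, hq, hr'⟩ : ∃ q r, r < n ∧ d = n * q + r ∧ d / n = q ∧ d % n = r :=
    ⟨_, _, Nat.mod_lt d hn, (Nat.div_add_mod d n).symm, rfl, rfl⟩
  have hrR : (r : ℝ) < n := by exact_mod_cast hr
  have hr0 : (0 : ℝ) ≤ r := Nat.cast_nonneg _
  rw [hq, hr', hd, Int.floor_eq_iff, le_div_iff₀ hn', div_lt_iff₀ hn']
  push_cast
  constructor <;> nlinarith

/-- For `1 < p < 2` and `k = ⌈log((1 - 2^(p-2))⁻¹)/log 2⌉ - 1`, the space `ℓ_p^d`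
contains an equilateral set of cardinality `⌊2^(k+1) d / (2^(k+1) - 1)⌋`. -/
theorem equilateral_lower_bound (p : ℝ) (hp1 : 1 < p) (hp2 : p < 2) (d : ℕ) (hd : 1 ≤ d)
    (k : ℤ) (hk : k = ⌈Real.log (1 - (2 : ℝ) ^ (p - 2))⁻¹ / Real.log 2⌉ - 1) :
    ∃ S : Finset (Fin d → ℝ), ∃ lam : ℝ, 0 < lam ∧ IsEquilateralLp p lam S ∧
      (S.card : ℤ) = ⌊(2 : ℝ) ^ (k + 1) * d / ((2 : ℝ) ^ (k + 1) - 1)⌋ := by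
  have hp0 : 0 < p := by linarith
  set w : ℝ := 2 ^ (p - 2) with hw
  have hw1 : w < 1 := Real.rpow_lt_one_of_one_lt_of_neg one_lt_two (by linarith)
  have hw2 : 1 / 2 < w := by
    have : (2 : ℝ) ^ (-1 : ℝ) < 2 ^ (p - 2) :=
      Real.rpow_lt_rpow_of_exponent_lt one_lt_two (by linarith)
    rwa [Real.rpow_neg_one, ← one_div] at this
  have hpw : (2 : ℝ) ^ p = 4 * w := by
    rw [hw, Real.rpow_sub two_pos, Real.rpow_two]; ring
  have hw3 : 0 < 1 - w := by linarith
  obtain ⟨h1, h2⟩ := two_zpow_bounds_of_eq_ceil_logb_sub_one (inv_pos.2 hw3) hk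
  have hk0 : 0 ≤ k := by
    by_contra! hneg
    have : (2 : ℝ) ^ (k + 1) ≤ 1 := zpow_le_one_of_nonpos₀ one_le_two (by omega)
    have : 1 < (1 - w)⁻¹ := (one_lt_inv₀ hw3).2 (by linarith)
    linarith
  lift k to ℕ using hk0
  rw [inv_le_iff_one_le_mul₀ hw3] at h2
  rw [← mul_lt_mul_iff_left₀ hw3, inv_mul_cancel₀ hw3.ne'] at h1
  have hz : (2 : ℝ) ^ ((k : ℤ) + 1) = 2 ^ (k + 1) := by exact_mod_cast zpow_natCast (2 : ℝ) (k + 1)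
  rw [hz] at h2 ⊢
  rw [zpow_natCast] at h1
  obtain ⟨n, hn⟩ : ∃ n, 2 ^ (k + 1) = n + 1 := Nat.exists_eq_add_one.2 (by positivity)
  have hn0 : 0 < n := by
    have : 2 ^ 1 ≤ 2 ^ (k + 1) := Nat.pow_le_pow_right two_pos (by omega)
    omega
  have hnR : (2 : ℝ) ^ (k + 1) = n + 1 := by exact_mod_cast hn
  have hblock := exists_isUnitEquilateral_two_pow hp0 hw2 hpw k h1 (by rw [pow_succ] at h2; linarith)
  rw [hn, Nat.add_sub_cancel] at hblock
  have hfam := exists_isUnitEquilateral_add hp0.ne'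
    (exists_isUnitEquilateral_mul hp0.ne' hblock (d / n))
    (exists_isUnitEquilateral_self hp0.ne' (d % n))
  rw [Nat.div_add_mod' d n] at hfam
  obtain ⟨x, hx⟩ := hfam
  obtain ⟨S, hS, hcard⟩ := hx.exists_finset hp0.ne'
  refine ⟨S, 2 ^ (1 / p), by positivity, hS, ?_⟩
  rw [hcard, hnR, add_sub_cancel_right, floor_succ_mul_div hn0]
end

section
/- Let 1 < p < 2, set k = ⌈log((1 − 2^{p−2})^{−1}) / log 2⌉ − 1, and suppose d ≥ 2^{k+2} − 2. Then there exists an equilateral set in ℓ_p^d of cardinality at least d + 2 (so the maximum size of an equilateral set in ℓ_p^d strictly exceeds d + 1). -/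
open Real

/-- The family `v` lies on the `ℓ_p`-sphere of radius `2 ^ (-1 / p)` about the origin,
and its members are at pairwise `ℓ_p`-distance one. -/
def IsHalfSimplex {κ ι : Type} [Fintype ι] (p : ℝ) (v : κ → ι → ℝ) : Prop :=
  (∀ x, ∑ i, |v x i| ^ p = 1 / 2) ∧ ∀ x y, x ≠ y → ∑ i, |v x i - v y i| ^ p = 1

theorem IsHalfSimplex.sum {κ ι κ' ι' : Type} [Fintype ι] [Fintype ι'] {p : ℝ} (hp : 0 < p)
    {v : κ → ι → ℝ} {w : κ' → ι' → ℝ} (hv : IsHalfSimplex p v) (hw : IsHalfSimplex p w) :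
    IsHalfSimplex p (Sum.elim (fun x => Sum.elim (v x) 0) (fun y => Sum.elim 0 (w y))) := by
  have h0 : (0 : ℝ) ^ p = 0 := Real.zero_rpow hp.ne'
  refine ⟨?_, ?_⟩
  · rintro (x | x)
    · simpa [h0] using hv.1 x
    · simpa [h0] using hw.1 x
  · rintro (x | x) (y | y) hxy
    · simpa [h0] using hv.2 x y (by simpa using hxy)
    · have h1 := hv.1 x
      have h2 := hw.1 y
      simp only [Sum.elim_inl, Sum.elim_inr, Fintype.sum_sum_type, Pi.zero_apply, sub_zero,
        zero_sub, abs_neg]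
      linarith
    · have h1 := hw.1 x
      have h2 := hv.1 y
      simp only [Sum.elim_inl, Sum.elim_inr, Fintype.sum_sum_type, Pi.zero_apply, sub_zero,
        zero_sub, abs_neg]
      linarith
    · simpa [h0] using hw.2 x y (by simpa using hxy)

theorem isHalfSimplex_single {κ : Type} [Fintype κ] [DecidableEq κ] {p : ℝ} (hp : 0 < p) :
    IsHalfSimplex p (fun x : κ => (Pi.single x ((1 / 2 : ℝ) ^ (1 / p)) : κ → ℝ)) := by
  have h0 : (0 : ℝ) ^ p = 0 := Real.zero_rpow hp.ne'
  have h1 : |(1 / 2 : ℝ) ^ (1 / p)| ^ p = 1 / 2 := by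
    rw [abs_of_nonneg (by positivity), ← Real.rpow_mul (by norm_num),
      one_div_mul_cancel hp.ne', Real.rpow_one]
  have key (x : κ) : ∑ i, |(Pi.single x ((1 / 2 : ℝ) ^ (1 / p)) : κ → ℝ) i| ^ p = 1 / 2 := by
    rw [Finset.sum_eq_single x]
    · rw [Pi.single_eq_same, h1]
    · intro i _ hi
      rw [Pi.single_eq_of_ne hi, abs_zero, h0]
    · simp
  refine ⟨key, fun x y hxy => ?_⟩
  have hsplit (i : κ) : |(Pi.single x ((1 / 2 : ℝ) ^ (1 / p)) : κ → ℝ) i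
        - (Pi.single y ((1 / 2 : ℝ) ^ (1 / p)) : κ → ℝ) i| ^ p
      = |(Pi.single x ((1 / 2 : ℝ) ^ (1 / p)) : κ → ℝ) i| ^ p
        + |(Pi.single y ((1 / 2 : ℝ) ^ (1 / p)) : κ → ℝ) i| ^ p := by
    by_cases hi : i = x
    · rw [Pi.single_eq_of_ne (show i ≠ y from hi ▸ hxy), abs_zero, h0, sub_zero, add_zero]
    · rw [Pi.single_eq_of_ne hi, abs_zero, h0, zero_sub, abs_neg, zero_add]
  rw [Finset.sum_congr rfl fun i _ => hsplit i, Finset.sum_add_distrib, key, key]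
  norm_num

/-- A normalized Sylvester Hadamard matrix of order `2 ^ m` with its constant column removed. -/
theorem exists_sylvester (m : ℕ) : ∃ (κ ι : Type) (_ : Fintype κ) (_ : Fintype ι)
    (h : κ → ι → ℝ), Fintype.card κ = 2 ^ m ∧ Fintype.card ι + 1 = 2 ^ m ∧
      (∀ x i, h x i = 1 ∨ h x i = -1) ∧ ∀ x y, x ≠ y → ∑ i, h x i * h y i = -1 := by
  induction m with
  | zero =>
    exact ⟨Unit, Empty, inferInstance, inferInstance, fun _ _ => 1, by simp, by simp, by simp,
      fun x y hxy => absurd rfl hxy⟩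
  | succ m ih =>
    obtain ⟨κ, ι, _, _, h, hκ, hι, hval, hinner⟩ := ih
    refine ⟨κ ⊕ κ, ι ⊕ ι ⊕ Unit, inferInstance, inferInstance,
      Sum.elim (fun x => Sum.elim (h x) (Sum.elim (h x) 1))
        (fun x => Sum.elim (h x) (Sum.elim (-h x) (-1))), ?_, ?_, ?_, ?_⟩
    · rw [Fintype.card_sum, hκ, pow_succ]; ring
    · simp only [Fintype.card_sum, Fintype.card_unit, pow_succ]; omega
    · rintro (x | x) (i | i | i)
      · exact hval x i
      · exact hval x i
      · simp
      · exact hval x i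
      · rcases hval x i with h | h <;> simp [h]
      · simp
    · rintro (x | x) (y | y) hxy
      · have := hinner x y (by simpa using hxy)
        simp [this]
      · simp
      · simp
      · have := hinner x y (by simpa using hxy)
        simp [this]

theorem exists_rpow_add_eq {p s c : ℝ} (hp : 0 < p) (hs : 0 ≤ s) (hc₁ : 2 ^ (p - 1) * s ≤ c)
    (hc₂ : c ≤ 2 * s) : ∃ a b : ℝ, 0 ≤ a ∧ 0 ≤ b ∧ a ^ p + b ^ p = s ∧
      |a - b| ^ p + |a + b| ^ p = c := by
  have hp' : 0 ≤ 1 / p := by positivity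
  have hroot {x : ℝ} (hx : 0 ≤ x) : (x ^ (1 / p)) ^ p = x := by
    rw [← Real.rpow_mul hx, one_div_mul_cancel hp.ne', Real.rpow_one]
  let F : ℝ → ℝ := fun t => |(s - t) ^ (1 / p) - t ^ (1 / p)| ^ p
    + |(s - t) ^ (1 / p) + t ^ (1 / p)| ^ p
  have hF : Continuous F := by
    have h1 : Continuous fun t : ℝ => (s - t) ^ (1 / p) :=
      (continuous_const.sub continuous_id).rpow_const fun _ => Or.inr hp'
    have h2 : Continuous fun t : ℝ => t ^ (1 / p) :=
      continuous_id.rpow_const fun _ => Or.inr hp'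
    exact ((h1.sub h2).abs.rpow_const fun _ => Or.inr hp.le).add
      ((h1.add h2).abs.rpow_const fun _ => Or.inr hp.le)
  have hF0 : F 0 = 2 * s := by
    have h0 : (0 : ℝ) ^ (1 / p) = 0 := Real.zero_rpow (by positivity)
    simp only [F, sub_zero, h0, add_zero]
    rw [abs_of_nonneg (by positivity), hroot hs]
    ring
  have hF1 : F (s / 2) = 2 ^ (p - 1) * s := by
    have h0 : (0 : ℝ) ^ p = 0 := Real.zero_rpow hp.ne'
    simp only [F, sub_half, sub_self, abs_zero, h0, zero_add]
    rw [abs_of_nonneg (by positivity), ← two_mul, Real.mul_rpow (by norm_num) (by positivity),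
      hroot (by positivity), Real.rpow_sub_one (by norm_num)]
    ring
  obtain ⟨t, ht, htc⟩ := intermediate_value_Icc' (show (0 : ℝ) ≤ s / 2 by positivity)
    hF.continuousOn (show c ∈ Set.Icc (F (s / 2)) (F 0) by rw [hF0, hF1]; exact ⟨hc₁, hc₂⟩)
  have hst : 0 ≤ s - t := by linarith [ht.2]
  refine ⟨(s - t) ^ (1 / p), t ^ (1 / p), by positivity, Real.rpow_nonneg ht.1 _, ?_, htc⟩
  rw [hroot hst, hroot ht.1]
  ring

theorem abs_sub_rpow_of_sign {p a b : ℝ} (hp : 0 < p) (ha : a = 1 ∨ a = -1)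
    (hb : b = 1 ∨ b = -1) : |a - b| ^ p = 2 ^ p / 2 * (1 - a * b) := by
  have h0 : (0 : ℝ) ^ p = 0 := Real.zero_rpow hp.ne'
  rcases ha with rfl | rfl <;> rcases hb with rfl | rfl <;> norm_num [h0]

theorem abs_rotate_rpow_of_sign {p a b : ℝ} (α β : ℝ) (ha : a = 1 ∨ a = -1)
    (hb : b = 1 ∨ b = -1) :
    |α * a - β * b| ^ p + |β * a + α * b| ^ p = |α - β| ^ p + |α + β| ^ p := by
  have h1 : |-α + β| = |α - β| := by rw [← abs_neg]; congr 1; ring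
  have h2 : |-α - β| = |α + β| := by rw [← abs_neg]; congr 1; ring
  have h3 : |β - α| = |α - β| := abs_sub_comm β α
  have h4 : |-β - α| = |α + β| := by rw [← abs_neg]; congr 1; ring
  have h5 : |-β + α| = |α - β| := by congr 1; ring
  have h6 : |β + α| = |α + β| := by rw [add_comm]
  rcases ha with rfl | rfl <;> rcases hb with rfl | rfl <;>
    simp only [mul_one, mul_neg, sub_neg_eq_add, ← sub_eq_add_neg, h1, h2, h3, h4, h5, h6] <;> ring

theorem exists_isHalfSimplex {p : ℝ} (hp1 : 1 < p) (m : ℕ)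
    (hlow : 1 - 1 / 2 ^ m ≤ (2 : ℝ) ^ (p - 2)) (hupp : (2 : ℝ) ^ (p - 2) ≤ 1 - 1 / 2 ^ (m + 1)) :
    ∃ (κ ι : Type) (_ : Fintype κ) (_ : Fintype ι) (v : κ → ι → ℝ),
      Fintype.card κ = 2 ^ (m + 1) ∧ Fintype.card ι + 1 = 2 ^ (m + 1) ∧ IsHalfSimplex p v := by
  obtain ⟨κ, ι, _, _, h, hκ, hι, hval, hinner⟩ := exists_sylvester m
  have hp : 0 < p := by linarith
  set N : ℝ := 2 ^ m with hN
  have hN1 : 1 ≤ N := one_le_pow₀ (by norm_num)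
  have hιN : (Fintype.card ι : ℝ) = N - 1 := by
    have : ((Fintype.card ι + 1 : ℕ) : ℝ) = N := by rw [hι]; push_cast; rfl
    push_cast at this; linarith
  set q : ℝ := 2 ^ (p - 2) with hq
  have hq0 : 0 < q := by positivity
  have hpq : (2 : ℝ) ^ p = 4 * q := by
    rw [hq, Real.rpow_sub (by norm_num)]; norm_num; ring
  have hpq1 : (2 : ℝ) ^ (p - 1) = 2 * q := by
    rw [Real.rpow_sub_one (by norm_num), hpq]; ring
  have hq2 : 1 < 2 * q := by
    rw [← hpq1]; exact Real.one_lt_rpow (by norm_num) (by linarith)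
  have hlow' : N - 1 ≤ q * N := by
    have := mul_le_mul_of_nonneg_right hlow (by linarith : 0 ≤ N)
    rwa [sub_mul, one_div_mul_cancel (by linarith), one_mul] at this
  have hupp' : 2 * q * N ≤ 2 * N - 1 := by
    have := mul_le_mul_of_nonneg_right hupp (by linarith : 0 ≤ 2 * N)
    rw [pow_succ, ← hN, mul_comm N 2, sub_mul, one_div_mul_cancel (by linarith)] at this
    linarith
  set s : ℝ := 1 / (2 * q * N) with hs
  have hs0 : 0 < s := by positivity
  have hsN : 2 * q * N * s = 1 := by rw [hs]; field_simp
  set g : ℝ := 1 / 2 - (N - 1) * s with hg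
  have hg0 : 0 ≤ g := by nlinarith
  obtain ⟨c, hc1, hc2, hc3⟩ : ∃ c, 2 ^ (p - 1) * s ≤ c ∧ c ≤ 2 * s ∧
      (N - 1) * c = 1 - 4 * q * g := by
    have hN1' : 0 < N - 1 := by
      have := mul_lt_mul_of_pos_right hq2 (by linarith : 0 < N)
      linarith
    have hlower : 2 * q * (1 + s) ≤ 2 := by
      refine le_of_mul_le_mul_right ?_ (by linarith : 0 < N)
      linarith
    refine ⟨(1 - 4 * q * g) / (N - 1), ?_, ?_, mul_div_cancel₀ _ hN1'.ne'⟩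
    · rw [le_div_iff₀ hN1', hpq1, hg]
      linarith
    · rw [div_le_iff₀ hN1', hg]
      have := mul_nonneg (sub_nonneg.2 hq2.le) hg0
      rw [hg] at this
      linarith
  obtain ⟨α, β, hα, hβ, hαβ, hcross⟩ := exists_rpow_add_eq hp hs0.le hc1 hc2
  set γ : ℝ := g ^ (1 / p) with hγ
  have hγ0 : 0 ≤ γ := by positivity
  have hγp : γ ^ p = g := by
    rw [hγ, ← Real.rpow_mul hg0, one_div_mul_cancel hp.ne', Real.rpow_one]
  have habs (x : κ) (i : ι) : |h x i| = 1 := by rcases hval x i with h | h <;> simp [h]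
  have hwithin (x y : κ) (hxy : x ≠ y) (c : ℝ) :
      ∑ i, |c * h x i - c * h y i| ^ p = |c| ^ p * (2 * q * N) := by
    have (i : ι) : |c * h x i - c * h y i| ^ p = |c| ^ p * (2 * q) * (1 - h x i * h y i) := by
      rw [← mul_sub, abs_mul, Real.mul_rpow (abs_nonneg _) (abs_nonneg _),
        abs_sub_rpow_of_sign hp (hval x i) (hval y i), hpq]
      ring
    rw [Finset.sum_congr rfl fun i _ => this i, ← Finset.mul_sum, Finset.sum_sub_distrib,
      hinner x y hxy]
    simp only [Finset.sum_const, Finset.card_univ, nsmul_eq_mul, mul_one, hιN]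
    ring
  have hopp (x y : κ) : ∑ i, |α * h x i - β * h y i| ^ p + (∑ i, |β * h x i + α * h y i| ^ p
      + (2 * γ) ^ p) = 1 := by
    rw [← add_assoc, ← Finset.sum_add_distrib,
      Finset.sum_congr rfl fun i _ => abs_rotate_rpow_of_sign α β (hval x i) (hval y i), hcross,
      Real.mul_rpow (by norm_num) hγ0, hγp, hpq]
    simp only [Finset.sum_const, Finset.card_univ, nsmul_eq_mul, hιN]
    linarith
  have hnorm (x : κ) (c : ℝ) (hc : 0 ≤ c) : ∑ i, |c * h x i| ^ p = (N - 1) * c ^ p := by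
    simp only [abs_mul, habs, abs_of_nonneg hc, mul_one, Finset.sum_const, Finset.card_univ,
      nsmul_eq_mul, hιN]
  refine ⟨κ ⊕ κ, ι ⊕ ι ⊕ Unit, inferInstance, inferInstance,
    Sum.elim (fun x => Sum.elim (fun i => α * h x i) (Sum.elim (fun i => β * h x i) fun _ => γ))
      (fun x => Sum.elim (fun i => β * h x i)
        (Sum.elim (fun i => -α * h x i) fun _ => -γ)), ?_, ?_, ?_, ?_⟩
  · rw [Fintype.card_sum, hκ, pow_succ]; ring
  · simp only [Fintype.card_sum, Fintype.card_unit, pow_succ]; omega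
  · rintro (x | x)
    · simp only [Fintype.sum_sum_type, Sum.elim_inl, Sum.elim_inr, hnorm x _ hα, hnorm x _ hβ,
        Finset.univ_unique, Finset.sum_singleton, abs_of_nonneg hγ0, hγp]
      linear_combination (N - 1) * hαβ + hg
    · simp only [Fintype.sum_sum_type, Sum.elim_inl, Sum.elim_inr, neg_mul, abs_neg,
        hnorm x _ hα, hnorm x _ hβ,
        Finset.univ_unique, Finset.sum_singleton, abs_of_nonneg hγ0, hγp]
      linear_combination (N - 1) * hαβ + hg
  · have h0 : (0 : ℝ) ^ p = 0 := Real.zero_rpow hp.ne'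
    have hfin : |α| ^ p * (2 * q * N) + |β| ^ p * (2 * q * N) = 1 := by
      rw [abs_of_nonneg hα, abs_of_nonneg hβ, ← add_mul, hαβ, mul_comm, hsN]
    rintro (x | x) (y | y) hxy
    · have hxy' : x ≠ y := by simpa using hxy
      simp only [Fintype.sum_sum_type, Sum.elim_inl, Sum.elim_inr, hwithin x y hxy',
        Finset.univ_unique, Finset.sum_singleton, sub_self, abs_zero, h0, add_zero, hfin]
    · have h2 : |γ + γ| = 2 * γ := by rw [← two_mul, abs_of_nonneg (by positivity)]
      simp only [Fintype.sum_sum_type, Sum.elim_inl, Sum.elim_inr, Finset.univ_unique,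
        Finset.sum_singleton, neg_mul, sub_neg_eq_add, h2]
      exact hopp x y
    · have h2 : |-γ - γ| = 2 * γ := by
        rw [← neg_add', abs_neg, ← two_mul, abs_of_nonneg (by positivity)]
      have h3 (i : ι) : |β * h x i - α * h y i| = |α * h y i - β * h x i| := abs_sub_comm _ _
      have h4 (i : ι) : |-α * h x i - β * h y i| = |β * h y i + α * h x i| := by
        rw [← abs_neg]; congr 1; ring
      simp only [Fintype.sum_sum_type, Sum.elim_inl, Sum.elim_inr, Finset.univ_unique,
        Finset.sum_singleton, h2, h3, h4]
      exact hopp y x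
    · have hxy' : x ≠ y := by simpa using hxy
      simp only [Fintype.sum_sum_type, Sum.elim_inl, Sum.elim_inr, hwithin x y hxy',
        Finset.univ_unique, Finset.sum_singleton, sub_self, abs_zero, h0, add_zero, abs_neg]
      linarith

theorem IsHalfSimplex.exists_finset {κ ι : Type} [Fintype κ] [Fintype ι] {p : ℝ} (hp : 0 < p)
    {v : κ → ι → ℝ} (hv : IsHalfSimplex p v) {d : ℕ} (hd : Fintype.card ι = d) :
    ∃ S : Finset (Fin d → ℝ), IsEquilateralLp p 1 S ∧ S.card = Fintype.card κ := by
  let e := Fintype.equivFinOfCardEq hd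
  have hdist (x y : κ) (hxy : x ≠ y) : ∑ i, |v x (e.symm i) - v y (e.symm i)| ^ p = 1 := by
    rw [← hv.2 x y hxy]
    exact e.symm.sum_comp fun i => |v x i - v y i| ^ p
  have hinj : Function.Injective fun (x : κ) (i : Fin d) => v x (e.symm i) := by
    intro x y hxy
    by_contra hne
    have h1 := hdist x y hne
    have h2 (i : Fin d) : v x (e.symm i) = v y (e.symm i) := congrFun hxy i
    simp [h2, Real.zero_rpow hp.ne'] at h1
  refine ⟨Finset.univ.map ⟨_, hinj⟩, ?_, by rw [Finset.card_map, Finset.card_univ]⟩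
  intro a ha b hb hab
  simp only [Finset.mem_map, Finset.mem_univ, true_and, Function.Embedding.coeFn_mk] at ha hb
  obtain ⟨x, rfl⟩ := ha
  obtain ⟨y, rfl⟩ := hb
  rw [hdist x y fun h => hab (by rw [h]), Real.one_rpow]

/-- For `1 < p < 2`, `k = ⌈log((1 - 2^(p-2))⁻¹)/log 2⌉ - 1` and `d ≥ 2^(k+2) - 2`,
the space `ℓ_p^d` contains an equilateral set of more than `d + 1` points. -/
theorem equilateral_gt_dim_add_one (p : ℝ) (hp1 : 1 < p) (hp2 : p < 2)
    (k : ℤ) (hk : k = ⌈Real.log (1 - (2 : ℝ) ^ (p - 2))⁻¹ / Real.log 2⌉ - 1)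
    (d : ℕ) (hd : (2 : ℝ) ^ (k + 2) - 2 ≤ (d : ℝ)) :
    ∃ S : Finset (Fin d → ℝ), ∃ lam : ℝ, 0 < lam ∧ IsEquilateralLp p lam S ∧
      d + 2 ≤ S.card := by
  have hp : 0 < p := by linarith
  have hlog2 : 0 < Real.log 2 := Real.log_pos (by norm_num)
  have hq1 : (2 : ℝ) ^ (p - 2) < 1 :=
    Real.rpow_lt_one_of_one_lt_of_neg (by norm_num) (by linarith)
  have hq0 : 0 < (2 : ℝ) ^ (p - 2) := by positivity
  set q : ℝ := 2 ^ (p - 2)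
  have hceil : ⌈Real.log (1 - q)⁻¹ / Real.log 2⌉ = k + 1 := by omega
  have hpos : 0 < Real.log (1 - q)⁻¹ / Real.log 2 :=
    div_pos (Real.log_pos ((one_lt_inv₀ (by linarith)).2 (by linarith))) hlog2
  have hk0 : 0 ≤ k := by
    have := Int.ceil_pos.2 hpos
    omega
  obtain ⟨m, rfl⟩ := Int.eq_ofNat_of_zero_le hk0
  obtain ⟨h1, h2⟩ := Int.ceil_eq_iff.1 hceil
  push_cast at h1 h2
  rw [add_sub_cancel_right, lt_div_iff₀ hlog2, ← Real.log_pow,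
    Real.log_lt_log_iff (by positivity) (by simpa using hq1),
    lt_inv_comm₀ (by positivity) (by linarith), ← one_div] at h1
  rw [← Nat.cast_succ, div_le_iff₀ hlog2, ← Real.log_pow,
    Real.log_le_log_iff (by simpa using hq1) (by positivity),
    inv_le_comm₀ (by linarith) (by positivity), ← one_div, Nat.succ_eq_add_one] at h2
  obtain ⟨κ, ι, _, _, v, hκ, hι, hv⟩ :=
    exists_isHalfSimplex hp1 m (by linarith) (by linarith)
  have hd' : 2 ^ (m + 2) ≤ d + 2 := by
    have : (2 : ℝ) ^ (m + 2) ≤ d + 2 := by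
      have h3 : (2 : ℝ) ^ ((m : ℤ) + 2) = 2 ^ (m + 2) := by norm_cast
      linarith
    exact_mod_cast this
  have hpow : 2 ^ (m + 2) = 2 * 2 ^ (m + 1) := by ring
  obtain ⟨S, hS, hcard⟩ := ((hv.sum hp hv).sum hp
    (isHalfSimplex_single (κ := Fin (d + 2 - 2 ^ (m + 2))) hp)).exists_finset hp (d := d) (by
      simp only [Fintype.card_sum, Fintype.card_fin]
      omega)
  refine ⟨S, 1, one_pos, hS, ?_⟩
  rw [hcard]
  simp only [Fintype.card_sum, Fintype.card_fin]
  omega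
end

section
/- For every p with 1 < p ≤ log(5/2)/log 2, there exists an equilateral set in ℓ_p^4 of cardinality 6. -/
open Real

/-- A family of `n` points whose distinct members are at the same positive distance (measured by
its `p`-th power) yields an equilateral set of `n` points. -/
theorem exists_isEquilateralLp_of_family {n d : ℕ} {p L : ℝ} (hp : 0 < p) (hL : 0 < L)
    (f : Fin n → Fin d → ℝ) (hf : ∀ i j, i < j → ∑ k, |f i k - f j k| ^ p = L) :
    ∃ S : Finset (Fin d → ℝ), ∃ lam : ℝ, 0 < lam ∧ IsEquilateralLp p lam S ∧ S.card = n := by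
  have hne : ∀ i j, i ≠ j → ∑ k, |f i k - f j k| ^ p = L := by
    intro i j hij
    rcases lt_or_gt_of_ne hij with h | h
    · exact hf i j h
    · simpa only [abs_sub_comm] using hf j i h
  have hinj : Function.Injective f := by
    intro i j hij
    by_contra h
    have := hne i j h
    simp [hij, Real.zero_rpow hp.ne'] at this
    exact hL.ne this
  refine ⟨Finset.univ.image f, L ^ (1 / p), by positivity, ?_, ?_⟩
  · intro x hx y hy hxy
    obtain ⟨i, -, rfl⟩ := Finset.mem_image.mp hx
    obtain ⟨j, -, rfl⟩ := Finset.mem_image.mp hy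
    rw [hne i j (fun h => hxy (h ▸ rfl))]
  · rw [Finset.card_image_of_injective _ hinj, Finset.card_univ, Fintype.card_fin]

/-- Writing `x = 2 ^ p`, there are `u, v ≥ 0` with `u ^ p + v ^ p = 2` such that
`|u - v| ^ p + |u + v| ^ p` equals `6 x - 2 x ^ 2`. -/
theorem exists_rpow_add_rpow_eq_two {p : ℝ} (hp : 0 < p) (h2 : 2 ≤ (2 : ℝ) ^ p)
    (h5 : (2 : ℝ) ^ p ≤ 5 / 2) :
    ∃ u v : ℝ, 0 ≤ u ∧ 0 ≤ v ∧ u ^ p + v ^ p = 2 ∧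
      |u - v| ^ p + |u + v| ^ p = 6 * 2 ^ p - 2 * (2 ^ p) ^ 2 := by
  let u : ℝ → ℝ := fun t => (1 + t) ^ (1 / p)
  let v : ℝ → ℝ := fun t => (1 - t) ^ (1 / p)
  have hu : Continuous u :=
    (continuous_const.add continuous_id).rpow_const fun _ => Or.inr (by positivity)
  have hv : Continuous v :=
    (continuous_const.sub continuous_id).rpow_const fun _ => Or.inr (by positivity)
  have hg : Continuous fun t => |u t - v t| ^ p + |u t + v t| ^ p :=
    ((hu.sub hv).abs.rpow_const fun _ => Or.inr hp.le).add
      ((hu.add hv).abs.rpow_const fun _ => Or.inr hp.le)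
  have h0 : |u 0 - v 0| ^ p + |u 0 + v 0| ^ p = 2 ^ p := by
    norm_num [u, v, Real.zero_rpow hp.ne']
  have h1 : |u 1 - v 1| ^ p + |u 1 + v 1| ^ p = 4 := by
    have hv1 : v 1 = 0 := by simp [v, Real.zero_rpow, hp.ne']
    have hu1 : |u 1| ^ p = 2 := by
      rw [abs_of_nonneg (by positivity), ← Real.rpow_mul (by norm_num),
        one_div_mul_cancel hp.ne', Real.rpow_one]
      norm_num
    rw [hv1, sub_zero, add_zero, hu1]
    norm_num
  obtain ⟨t, ⟨ht0, ht1⟩, ht⟩ := intermediate_value_Icc zero_le_one hg.continuousOn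
    (show 6 * (2 : ℝ) ^ p - 2 * (2 ^ p) ^ 2 ∈ Set.Icc _ _ from
      ⟨by rw [h0]; nlinarith, by rw [h1]; nlinarith⟩)
  have hup : 0 ≤ 1 + t := by linarith
  have hvp : 0 ≤ 1 - t := by linarith
  refine ⟨u t, v t, Real.rpow_nonneg hup _, Real.rpow_nonneg hvp _, ?_, ht⟩
  rw [← Real.rpow_mul hup, ← Real.rpow_mul hvp, one_div_mul_cancel hp.ne', Real.rpow_one,
    Real.rpow_one]
  ring

/-- For `1 < p ≤ log(5/2)/log 2`, the space `ℓ_p^4` contains an equilateral set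
of `6` points. -/
theorem equilateral_six_points_dim_four (p : ℝ) (hp1 : 1 < p)
    (hp2 : p ≤ Real.log (5 / 2) / Real.log 2) :
    ∃ S : Finset (Fin 4 → ℝ), ∃ lam : ℝ, 0 < lam ∧ IsEquilateralLp p lam S ∧
      S.card = 6 := by
  have hp : 0 < p := by linarith
  have h2 : (2 : ℝ) ≤ 2 ^ p := by
    simpa using Real.rpow_le_rpow_of_exponent_le (one_le_two (α := ℝ)) hp1.le
  have h5 : (2 : ℝ) ^ p ≤ 5 / 2 := by
    have hlog := (le_div_iff₀ (Real.log_pos one_lt_two)).mp hp2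
    rwa [← Real.log_rpow two_pos, Real.log_le_log_iff (by positivity) (by norm_num)] at hlog
  obtain ⟨u, v, hu, hv, huv, hdiff⟩ := exists_rpow_add_rpow_eq_two hp h2 h5
  obtain ⟨c, hc, hcp⟩ : ∃ c : ℝ, 0 ≤ c ∧ c ^ p = 2 * 2 ^ p - 4 :=
    ⟨_, Real.rpow_nonneg (by linarith) _, Real.rpow_inv_rpow (by linarith) hp.ne'⟩
  obtain ⟨s, hs, hsp⟩ : ∃ s : ℝ, 0 ≤ s ∧ s ^ p = 2 :=
    ⟨_, Real.rpow_nonneg zero_le_two _, Real.rpow_inv_rpow zero_le_two hp.ne'⟩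
  have add_self_rpow {a : ℝ} (ha : 0 ≤ a) : (a + a) ^ p = 2 ^ p * a ^ p := by
    rw [← two_mul, Real.mul_rpow zero_le_two ha]
  have neg_sub_abs (a b : ℝ) : |-a - b| = |a + b| := by rw [← abs_neg]; ring_nf
  have neg_add_abs (a b : ℝ) : |-a + b| = |a - b| := by rw [← abs_neg]; ring_nf
  refine exists_isEquilateralLp_of_family hp (L := 2 * 2 ^ p) (by positivity)
    ![![u, v, c, 0], ![-u, -v, c, 0], ![v, -u, -c, 0], ![-v, u, -c, 0],
      ![0, 0, 0, s], ![0, 0, 0, -s]] ?_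
  have hsub : |v - u| = |u - v| := abs_sub_comm v u
  have hadd : |v + u| = |u + v| := by rw [add_comm]
  have hscaled : 2 ^ p * u ^ p + 2 ^ p * v ^ p = 2 * 2 ^ p := by rw [← mul_add, huv, mul_comm]
  intro i j hij
  fin_cases i <;> fin_cases j <;> first
    | exact absurd hij (by decide)
    | (simp [Fin.sum_univ_four, Real.zero_rpow hp.ne', neg_sub_abs, neg_add_abs, hsub, hadd,
        add_self_rpow, abs_of_nonneg, hu, hv, hc, hs, hcp, hsp]
       linarith)
end
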